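/- arXiv:2205.14078 — 2 statements merged into one kernel-verified Lean document; each statement's English description precedes it below -/
import Mathlib

section
/- Let R be a commutative ring and x_1, x_2, x_3, … a sequence of elements of R. For all N, n, m ∈ ℕ: Σ_{a+b=N} (−1)^a · e_a(x_1,…,x_n) · h_b(x_1,…,x_m) equals (−1)^N e_N(x_{m+1}, x_{m+2}, …, x_n) when n ≥ m, and equals h_N(x_{n+1}, x_{n+2}, …, x_m) when n ≤ m. -/
open Finset

/-- The j-th elementary symmetric polynomial in the values x 0, ..., x (m-1). -/
noncomputable def esym {R : Type*} [CommRing R] (x : ℕ → R) (m j : ℕ) : R :=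
  ∑ S ∈ (Finset.range m).powersetCard j, ∏ i ∈ S, x i

/-- The j-th complete homogeneous symmetric polynomial in x 0, ..., x (m-1). -/
noncomputable def hsym {R : Type*} [CommRing R] (x : ℕ → R) (m j : ℕ) : R :=
  ∑ t ∈ (Finset.range m).sym j, ((t : Multiset ℕ).map x).prod


lemma esym_zero' {R : Type*} [CommRing R] (x : ℕ → R) (m : ℕ) : esym x m 0 = 1 := by
  simp [esym]

lemma esym_rec {R : Type*} [CommRing R] (x : ℕ → R) (m j : ℕ) :
    esym x (m+1) (j+1) = esym x m (j+1) + x m * esym x m j := by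
  unfold esym
  have hm : m ∉ Finset.range m := by simp
  rw [Finset.range_add_one, Finset.powersetCard_succ_insert hm, Finset.sum_union, Finset.sum_image,
    Finset.mul_sum]
  · congr 1
    refine Finset.sum_congr rfl fun S hS => ?_
    rw [Finset.prod_insert]
    intro h
    exact hm ((Finset.mem_powersetCard.1 hS).1 h)
  · intro S hS T hT h
    have hS' : m ∉ S := fun h => hm ((Finset.mem_powersetCard.1 hS).1 h)
    have hT' : m ∉ T := fun h => hm ((Finset.mem_powersetCard.1 hT).1 h)
    rw [← Finset.erase_insert hS', ← Finset.erase_insert hT']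
    exact congrArg (fun U => Finset.erase U m) h
  · rw [Finset.disjoint_left]
    intro S hS hS'
    obtain ⟨T, _, rfl⟩ := Finset.mem_image.1 hS'
    exact hm ((Finset.mem_powersetCard.1 hS).1 (Finset.mem_insert_self _ _))

lemma hsym_zero' {R : Type*} [CommRing R] (x : ℕ → R) (m : ℕ) : hsym x m 0 = 1 := by
  simp [hsym]
  exact Multiset.prod_zero

lemma hsym_rec {R : Type*} [CommRing R] (x : ℕ → R) (m j : ℕ) :
    hsym x (m+1) (j+1) = hsym x m (j+1) + x m * hsym x (m+1) j := by
  unfold hsym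
  rw [← Finset.sum_filter_add_sum_filter_not _ (fun t : Sym ℕ (j+1) => m ∉ t)]
  congr 1
  · refine Finset.sum_congr ?_ fun _ _ => rfl
    ext t
    simp only [Finset.mem_filter, Finset.mem_sym_iff, Finset.mem_range]
    constructor
    · rintro ⟨h, h'⟩ a ha
      have := h a ha
      have : a ≠ m := by rintro rfl; exact h' ha
      omega
    · intro h
      exact ⟨fun a ha => (h a ha).trans (Nat.lt_succ_self _), fun h' => lt_irrefl _ (h m h')⟩
  · rw [Finset.mul_sum]
    symm
    refine Finset.sum_bij (fun t _ => Sym.cons m t) ?_ ?_ ?_ ?_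
    · intro t ht
      simp only [Finset.mem_filter, Finset.mem_sym_iff, Finset.mem_range] at ht ⊢
      refine ⟨?_, by simp⟩
      intro a ha
      rcases Sym.mem_cons.1 ha with rfl | ha
      · omega
      · exact ht a ha
    · intro s _ t _ h
      exact Sym.cons_inj_right m s t |>.1 h
    · intro t ht
      simp only [Finset.mem_filter, Finset.mem_sym_iff, Finset.mem_range, not_not] at ht
      refine ⟨t.erase m ht.2, ?_, Sym.cons_erase ht.2⟩
      rw [Finset.mem_sym_iff]
      intro a ha
      rw [Finset.mem_range]
      apply ht.1
      rw [← Sym.cons_erase ht.2]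
      exact Sym.mem_cons_of_mem ha
    · intro t _
      rw [Sym.coe_cons, Multiset.map_cons, Multiset.prod_cons]

open PowerSeries in
lemma E_eq {R : Type*} [CommRing R] (x : ℕ → R) (m : ℕ) :
    PowerSeries.mk (fun j => (-1 : R)^j * esym x m j)
      = ∏ i ∈ Finset.range m, (1 - PowerSeries.C (x i) * PowerSeries.X) := by
  induction m with
  | zero =>
    ext j
    cases j with
    | zero => simp [esym]
    | succ j =>
      have h : Finset.powersetCard (j+1) (∅ : Finset ℕ) = ∅ :=
        Finset.powersetCard_eq_empty.2 (by simp)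
      simp [esym, PowerSeries.coeff_one, h]
  | succ m ih =>
    rw [Finset.prod_range_succ, ← ih]
    ext j
    rw [mul_sub, mul_one, mul_left_comm, ← mul_assoc, mul_assoc, map_sub, PowerSeries.coeff_C_mul]
    cases j with
    | zero => simp [esym_zero']
    | succ j =>
      simp only [PowerSeries.coeff_succ_mul_X, PowerSeries.coeff_mk, esym_rec]
      ring

lemma H_mul {R : Type*} [CommRing R] (x : ℕ → R) (m : ℕ) :
    (∏ i ∈ Finset.range m, (1 - PowerSeries.C (x i) * PowerSeries.X))
      * PowerSeries.mk (fun j => hsym x m j) = 1 := by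
  induction m with
  | zero =>
    ext j
    cases j with
    | zero => simp [hsym_zero']
    | succ j => simp [hsym, PowerSeries.coeff_one]
  | succ m ih =>
    rw [Finset.prod_range_succ, mul_assoc]
    refine Eq.trans ?_ ih
    congr 1
    ext j
    rw [sub_mul, one_mul, mul_assoc, map_sub, PowerSeries.coeff_C_mul]
    cases j with
    | zero => simp [hsym_zero']
    | succ j =>
      simp only [PowerSeries.coeff_succ_X_mul, PowerSeries.coeff_mk, hsym_rec]
      ring

lemma sum_eq_coeff {R : Type*} [CommRing R] (x : ℕ → R) (N n m : ℕ) :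
    ∑ a ∈ Finset.range (N+1), (-1 : R)^a * esym x n a * hsym x m (N - a)
      = PowerSeries.coeff N ((∏ i ∈ Finset.range n, (1 - PowerSeries.C (x i) * PowerSeries.X))
        * PowerSeries.mk (fun j => hsym x m j)) := by
  rw [← E_eq, PowerSeries.coeff_mul, Finset.Nat.sum_antidiagonal_eq_sum_range_succ_mk]
  simp

theorem esym_hsym_alternating {R : Type*} [CommRing R] (x : ℕ → R) (N n m : ℕ) :
    (m ≤ n → ∑ a ∈ Finset.range (N+1), (-1 : R)^a * esym x n a * hsym x m (N - a)
        = (-1 : R)^N * esym (fun i => x (m + i)) (n - m) N) ∧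
    (n ≤ m → ∑ a ∈ Finset.range (N+1), (-1 : R)^a * esym x n a * hsym x m (N - a)
        = hsym (fun i => x (n + i)) (m - n) N) := by
  rw [sum_eq_coeff]
  constructor
  · intro h
    obtain ⟨k, rfl⟩ := Nat.exists_eq_add_of_le h
    rw [Finset.prod_range_add, mul_right_comm, H_mul, one_mul,
      ← E_eq (fun i => x (m + i)) k, PowerSeries.coeff_mk, Nat.add_sub_cancel_left]
  · intro h
    obtain ⟨k, rfl⟩ := Nat.exists_eq_add_of_le h
    have h1 := H_mul x (n + k)
    have h2 := H_mul (fun i => x (n + i)) k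
    rw [Finset.prod_range_add] at h1
    rw [Nat.add_sub_cancel_left, ← PowerSeries.coeff_mk N (fun j => hsym (fun i => x (n + i)) k j)]
    congr 1
    linear_combination (PowerSeries.mk (fun j => hsym (fun i => x (n + i)) k j)) * h1
      - (∏ i ∈ Finset.range n, (1 - PowerSeries.C (x i) * PowerSeries.X))
        * PowerSeries.mk (fun j => hsym x (n + k) j) * h2
end

section
/- For every integer m ≥ 1 and every n ∈ ℕ, the polynomial q^m − q divides (Σ_{k=0}^n (−1)^{n−k} q^{m(n−k)} · S_B^o[n,k]) − 1 in ℤ[q]. -/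
open Polynomial Finset

/-- The q-integer [m]_q = 1 + q + ... + q^(m-1) in ℤ[q]. -/
noncomputable def qInt (m : ℕ) : Polynomial ℤ := ∑ i ∈ Finset.range m, Polynomial.X ^ i

/-- The q-double factorial [2k]_q!! = [2k]_q [2k-2]_q ⋯ [2]_q in ℤ[q]. -/
noncomputable def qDFact (k : ℕ) : Polynomial ℤ := ∏ i ∈ Finset.range k, qInt (2*(i+1))

/-- Type B q-Stirling numbers of the second kind. -/
noncomputable def SB : ℕ → ℕ → Polynomial ℤ
  | 0, k => if k = 0 then 1 else 0
  | n+1, 0 => qInt 1 * SB n 0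
  | n+1, k+1 => SB n k + qInt (2*(k+1)+1) * SB n (k+1)

theorem SB_zero_of_lt (n : ℕ) : ∀ k, n < k → SB n k = 0 := by
  induction n with
  | zero => intro k hk; simp [SB]; omega
  | succ n ih =>
    intro k hk
    cases k with
    | zero => omega
    | succ k => rw [SB, ih k (by omega), ih (k+1) (by omega)]; simp

theorem SBo_exact (n : ℕ) :
    ∑ k ∈ Finset.range (n+1), (-X : Polynomial ℤ)^(n-k) * (qDFact k * SB n k) = 1 := by
  induction n with
  | zero => simp [SB, qDFact]
  | succ n ih =>
    have h2 : ∑ k ∈ Finset.range (n+2),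
        (-X : Polynomial ℤ)^(n+1-k) * (qDFact k * (qInt (2*k+1) * SB n k)) =
        ∑ k ∈ Finset.range (n+1),
          (-X * qInt (2*k+1)) * ((-X : Polynomial ℤ)^(n-k) * (qDFact k * SB n k)) := by
      rw [Finset.sum_range_succ, SB_zero_of_lt n (n+1) (by omega)]
      simp only [mul_zero, add_zero]
      refine Finset.sum_congr rfl fun k hk => ?_
      rw [Finset.mem_range] at hk
      rw [show n+1-k = (n-k)+1 by omega, pow_succ]
      ring
    have h1 : ∑ k ∈ Finset.range (n+2), (-X : Polynomial ℤ)^(n+1-k) * (qDFact k * SB (n+1) k)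
        = ∑ k ∈ Finset.range (n+1),
            qInt (2*(k+1)) * ((-X : Polynomial ℤ)^(n-k) * (qDFact k * SB n k))
          + ∑ k ∈ Finset.range (n+2),
        (-X : Polynomial ℤ)^(n+1-k) * (qDFact k * (qInt (2*k+1) * SB n k)) := by
      rw [Finset.sum_range_succ' _ (n+1), Finset.sum_range_succ' _ (n+1), ← add_assoc,
        ← Finset.sum_add_distrib]
      congr 1
      refine Finset.sum_congr rfl fun k hk => ?_
      rw [SB, Nat.add_sub_add_right, qDFact, Finset.prod_range_succ, ← qDFact]
      ring
    rw [show n+1+1 = n+2 from rfl, h1, h2, ← Finset.sum_add_distrib, ← ih]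
    refine Finset.sum_congr rfl fun k hk => ?_
    have : qInt (2*(k+1)) = 1 + X * qInt (2*k+1) := by
      rw [show 2*(k+1) = (2*k+1)+1 by ring, qInt, Finset.sum_range_succ', qInt, Finset.mul_sum]
      simp only [pow_succ, pow_zero]
      rw [add_comm]
      congr 1
      exact Finset.sum_congr rfl fun i _ => by ring
    rw [this]
    ring

theorem SBo_divisibility (m : ℕ) (hm : 1 ≤ m) (n : ℕ) :
    (Polynomial.X^m - Polynomial.X : Polynomial ℤ) ∣
      (∑ k ∈ Finset.range (n+1),
          (-1 : Polynomial ℤ)^(n-k) * Polynomial.X^(m*(n-k)) * (qDFact k * SB n k)) - 1 := by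
  have e := SBo_exact n
  generalize hA : (∑ k ∈ Finset.range (n+1), (-1 : Polynomial ℤ)^(n-k) * Polynomial.X^(m*(n-k)) * (qDFact k * SB n k)) = A
  rw [← e, ← hA, ← Finset.sum_sub_distrib]
  refine Finset.dvd_sum fun k _ => ?_
  have h : (X^m - X : Polynomial ℤ) ∣ (X^m)^(n-k) - X^(n-k) := sub_dvd_pow_sub_pow _ _ _
  obtain ⟨c, hc⟩ := h
  refine ⟨(-1)^(n-k) * (qDFact k * SB n k) * c, ?_⟩
  rw [neg_pow (X : Polynomial ℤ), pow_mul]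
  linear_combination ((-1)^(n-k) * (qDFact k * SB n k)) * hc
end
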